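/- Let R : ℝ^ℓ → ℂ be a C^{2M+1} function supported in a fixed ball, satisfying |∇^k R(μ)| ≤ C |μ|^{2M+1−k} for all 0 ≤ k ≤ 2M+1. Then |∫_{ℝ^ℓ} e^{it|μ|²} R(μ) e^{−|μ|²} χ(μ) dμ| ≤ C' |t|^{−M} for |t| ≥ 1, where χ is a smooth compactly supported cut-off. -/

import Mathlib

open Complex MeasureTheory

lemma polar_aux {E : Type*} [NormedAddCommGroup E] [NormedSpace ℝ E] [MeasurableSpace E]
    [Nontrivial E] (μ : Measure E) [FiniteDimensional ℝ E] [BorelSpace E] [μ.IsAddHaarMeasure]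
    (F : E → ℂ) (hF : Integrable F μ) :
    ∫ x, F x ∂μ = ∫ ω : Metric.sphere (0 : E) 1,
      ∫ y in Set.Ioi (0 : ℝ), (y ^ (Module.finrank ℝ E - 1)) • F (y • (ω : E)) ∂volume
        ∂μ.toSphere := by
  have hmp := μ.measurePreserving_homeomorphUnitSphereProd
  have hme := (homeomorphUnitSphereProd E).measurableEmbedding
  have key : ∀ x : ({(0)}ᶜ : Set E), F x.1 =
      (fun p : Metric.sphere (0 : E) 1 × Set.Ioi (0 : ℝ) => F (p.2.1 • p.1.1))
        (homeomorphUnitSphereProd E x) := by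
    intro x
    have hx : ‖(x : E)‖ ≠ 0 := norm_ne_zero_iff.2 x.2
    simp [smul_smul, hx]
  calc
    ∫ x, F x ∂μ = ∫ x : ({(0)}ᶜ : Set E), F x.1 ∂(μ.comap (↑)) := by
      rw [integral_subtype_comap (measurableSet_singleton _).compl fun x ↦ F x,
        restrict_compl_singleton]
    _ = ∫ p : Metric.sphere (0 : E) 1 × Set.Ioi (0 : ℝ), F (p.2.1 • p.1.1)
          ∂μ.toSphere.prod (.volumeIoiPow (Module.finrank ℝ E - 1)) := by
      rw [← hmp.integral_comp hme]
      exact integral_congr_ae (.of_forall key)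
    _ = ∫ ω : Metric.sphere (0 : E) 1, ∫ y : Set.Ioi (0 : ℝ), F (y.1 • ω.1)
          ∂(.volumeIoiPow (Module.finrank ℝ E - 1)) ∂μ.toSphere := by
      rw [integral_prod]
      rw [← hmp.integrable_comp_emb hme]
      have h1 : Integrable (fun x : ({(0)}ᶜ : Set E) => F x.1) (μ.comap (↑)) := by
        have := (integrableOn_iff_comap_subtypeVal (μ := μ) (f := F)
          (measurableSet_singleton (0 : E)).compl).1 hF.integrableOn
        exact this
      exact h1.congr (.of_forall key)
    _ = _ := by
      refine integral_congr_ae (.of_forall fun ω => ?_)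
      simp only [Measure.volumeIoiPow, ENNReal.ofReal]
      rw [integral_withDensity_eq_integral_smul,
        integral_subtype_comap measurableSet_Ioi
          fun a ↦ Real.toNNReal (a ^ (Module.finrank ℝ E - 1)) • F (a • ω.1),
        setIntegral_congr_fun measurableSet_Ioi fun x hx ↦ ?_]
      · rw [NNReal.smul_def, Real.coe_toNNReal _ (pow_nonneg hx.out.le _)]
      · exact (measurable_subtype_coe.pow_const _).real_toNNReal

lemma term_bound {n m : ℕ} {b C : ℝ} {h : ℝ → ℂ}
    (hb : ∀ k ≤ n, ∀ r ∈ Set.Ioc 0 b, ‖iteratedDeriv k h r‖ ≤ C * r ^ ((m : ℤ) - k))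
    {j : ℕ} (hj : j ≤ n) (q : ℤ) (t : ℝ) {r : ℝ} (hr : r ∈ Set.Ioc 0 b) :
    ‖exp (I * t * r ^ 2) * (iteratedDeriv j h r * (r : ℂ) ^ q)‖ ≤ C * r ^ ((m : ℤ) - j + q) := by
  have h1 : ‖exp (I * t * r ^ 2)‖ = 1 := by
    have : I * t * (r : ℂ) ^ 2 = ((t * r ^ 2 : ℝ) : ℂ) * I := by push_cast; ring
    rw [this, norm_exp_ofReal_mul_I]
  rw [norm_mul, h1, one_mul, norm_mul, norm_zpow, norm_real, Real.norm_of_nonneg hr.1.le,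
    zpow_add₀ hr.1.ne', ← mul_assoc]
  exact mul_le_mul_of_nonneg_right (hb j hj r hr) (zpow_nonneg hr.1.le _)

lemma term_bound' {n m : ℕ} {b C : ℝ} (hC : 0 ≤ C) {h : ℝ → ℂ}
    (hb : ∀ k ≤ n, ∀ r ∈ Set.Ioc 0 b, ‖iteratedDeriv k h r‖ ≤ C * r ^ ((m : ℤ) - k))
    {j : ℕ} (hj : j ≤ n) (q : ℤ) (hq : 0 ≤ (m : ℤ) - j + q) (t : ℝ) {r : ℝ}
    (hr : r ∈ Set.Ioc 0 b) :
    ‖exp (I * t * r ^ 2) * (iteratedDeriv j h r * (r : ℂ) ^ q)‖ ≤ C * b ^ ((m : ℤ) - j + q) := by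
  refine (term_bound hb hj q t hr).trans ?_
  obtain ⟨e, he⟩ := Int.eq_ofNat_of_zero_le hq
  rw [he]
  simp only [zpow_natCast]
  exact mul_le_mul_of_nonneg_left (pow_le_pow_left₀ hr.1.le hr.2 _) hC

lemma term_integrable {n m : ℕ} {b C : ℝ} (hb0 : 0 < b) (hC : 0 ≤ C) {h : ℝ → ℂ}
    (hh : ContDiff ℝ n h)
    (hb : ∀ k ≤ n, ∀ r ∈ Set.Ioc 0 b, ‖iteratedDeriv k h r‖ ≤ C * r ^ ((m : ℤ) - k))
    {j : ℕ} (hj : j ≤ n) (q : ℤ) (hq : 0 ≤ (m : ℤ) - j + q) (t : ℝ) :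
    IntervalIntegrable (fun r : ℝ => exp (I * t * r ^ 2) * (iteratedDeriv j h r * (r : ℂ) ^ q))
      volume 0 b := by
  rw [intervalIntegrable_iff_integrableOn_Ioc_of_le hb0.le]
  refine Measure.integrableOn_of_bounded (M := C * b ^ ((m : ℤ) - j + q)) (by simp) ?_ ?_
  · have h1 : Measurable (iteratedDeriv j h) :=
      (hh.continuous_iteratedDeriv j (by exact_mod_cast hj)).measurable
    have h2 : Measurable (fun r : ℝ => (r : ℂ) ^ q) := Complex.measurable_ofReal.pow_const q
    have h3 : Measurable (fun r : ℝ => exp (I * t * r ^ 2)) := by fun_prop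
    exact (h3.mul (h1.mul h2)).aestronglyMeasurable
  · exact (ae_restrict_mem measurableSet_Ioc).mono
      fun r hr => term_bound' hC hb hj q hq t hr

lemma one_dim (n m : ℕ) (b C : ℝ) (hb0 : 0 < b) (hC : 0 ≤ C) (N : ℕ) :
    ∀ (j : ℕ) (q : ℤ), j + N ≤ n → (2 * N : ℤ) ≤ (m : ℤ) - j + q →
    ∃ K : ℝ, 0 ≤ K ∧ ∀ h : ℝ → ℂ, ContDiff ℝ n h → (∀ k ≤ n, iteratedDeriv k h b = 0) →
      (∀ k ≤ n, ∀ r ∈ Set.Ioc 0 b, ‖iteratedDeriv k h r‖ ≤ C * r ^ ((m : ℤ) - k)) →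
      ∀ t : ℝ, |t| ^ N * ‖∫ r in (0 : ℝ)..b,
        exp (I * t * r ^ 2) * (iteratedDeriv j h r * (r : ℂ) ^ q)‖ ≤ K := by
  induction N with
  | zero =>
    intro j q hj hq
    refine ⟨C * b ^ ((m : ℤ) - j + q) * |b - 0|, by positivity, fun h hh hz hb t => ?_⟩
    rw [pow_zero, one_mul]
    refine intervalIntegral.norm_integral_le_of_norm_le_const fun r hr => ?_
    rw [Set.uIoc_of_le hb0.le] at hr
    exact term_bound' hC hb (by omega) q (by simpa using hq) t hr
  | succ N ih =>
    intro j q hj hq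
    push_cast at hq
    obtain ⟨K1, hK1, H1⟩ := ih (j + 1) (q - 1) (by omega) (by push_cast; linarith)
    obtain ⟨K2, hK2, H2⟩ := ih j (q - 2) (by omega) (by linarith)
    refine ⟨(K1 + |(q : ℝ) - 1| * K2) / 2, by positivity, fun h hh hz hb t => ?_⟩
    have B1 := H1 h hh hz hb t
    have B2 := H2 h hh hz hb t
    set T : ℕ → ℤ → ℝ → ℂ := fun j q r =>
      exp (I * t * r ^ 2) * (iteratedDeriv j h r * (r : ℂ) ^ q) with hT
    change |t| ^ N * ‖∫ r in (0 : ℝ)..b, T (j + 1) (q - 1) r‖ ≤ K1 at B1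
    change |t| ^ N * ‖∫ r in (0 : ℝ)..b, T j (q - 2) r‖ ≤ K2 at B2
    change |t| ^ (N + 1) * ‖∫ r in (0 : ℝ)..b, T j q r‖ ≤ _
    have i0 : IntervalIntegrable (T j q) volume 0 b :=
      term_integrable hb0 hC hh hb (by omega) q (by linarith) t
    have i1 : IntervalIntegrable (T (j + 1) (q - 1)) volume 0 b :=
      term_integrable hb0 hC hh hb (by omega) _ (by push_cast; linarith) t
    have i2 : IntervalIntegrable (T j (q - 2)) volume 0 b :=
      term_integrable hb0 hC hh hb (by omega) _ (by linarith) t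
    have hd : ∀ r ∈ Set.Ioo 0 b, HasDerivAt (T j (q - 1))
        (2 * I * t * T j q r + T (j + 1) (q - 1) r + ((q : ℂ) - 1) * T j (q - 2) r) r := by
      intro r hr
      have hr0 : (r : ℂ) ≠ 0 := by exact_mod_cast hr.1.ne'
      have d1 : HasDerivAt (fun r : ℝ => exp (I * t * (r : ℂ) ^ 2))
          (exp (I * t * (r : ℂ) ^ 2) * (I * t * (2 * r))) r := by
        have := ((((hasDerivAt_id (r : ℂ)).pow 2).const_mul (I * t)).cexp).comp_ofReal
        simpa using this
      have d2 : HasDerivAt (iteratedDeriv j h) (iteratedDeriv (j + 1) h r) r := by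
        rw [iteratedDeriv_succ]
        exact (hh.differentiable_iteratedDeriv j (by exact_mod_cast (by omega : j < n)) r).hasDerivAt
      have d3 : HasDerivAt (fun r : ℝ => (r : ℂ) ^ (q - 1))
          (((q - 1 : ℤ) : ℂ) * (r : ℂ) ^ (q - 1 - 1)) r :=
        (hasDerivAt_zpow (q - 1) (r : ℂ) (Or.inl hr0)).comp_ofReal
      refine (d1.mul (d2.mul d3)).congr_deriv ?_
      have e1 : (r : ℂ) ^ q = (r : ℂ) ^ (q - 1) * r := by
        rw [← zpow_add_one₀ hr0]; congr 1; ring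
      have e2 : q - 1 - 1 = q - 2 := by ring
      simp only [hT, e1, e2, Pi.mul_apply]
      push_cast
      ring
    have hint : IntervalIntegrable (fun r => 2 * I * t * T j q r + T (j + 1) (q - 1) r +
        ((q : ℂ) - 1) * T j (q - 2) r) volume 0 b :=
      ((i0.const_mul _).add i1).add (i2.const_mul _)
    have l0 : Filter.Tendsto (T j (q - 1)) (nhdsWithin 0 (Set.Ioi 0)) (nhds 0) := by
      obtain ⟨e, he⟩ := Int.eq_ofNat_of_zero_le (a := (m : ℤ) - j + (q - 1) - 1) (by linarith)
      have he' : (m : ℤ) - j + (q - 1) = ((e + 1 : ℕ) : ℤ) := by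
        push_cast; push_cast at he; linarith
      refine squeeze_zero_norm' (a := fun r => C * r ^ (e + 1)) ?_ ?_
      · filter_upwards [Ioc_mem_nhdsGT hb0] with r hr
        have := term_bound hb (by omega : j ≤ n) (q - 1) t hr
        rw [he', zpow_natCast] at this
        exact this
      · have : Continuous (fun r : ℝ => C * r ^ (e + 1)) := by fun_prop
        have := this.tendsto 0
        simp only [ne_eq, Nat.add_eq_zero_iff, one_ne_zero, and_false, not_false_eq_true, zero_pow,
          mul_zero] at this
        exact this.mono_left nhdsWithin_le_nhds
    have lb : Filter.Tendsto (T j (q - 1)) (nhdsWithin b (Set.Iio b)) (nhds 0) := by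
      have hbc : (b : ℂ) ≠ 0 := by exact_mod_cast hb0.ne'
      have c : ContinuousAt (T j (q - 1)) b := by
        have c1 : ContinuousAt (iteratedDeriv j h) b :=
          (hh.continuous_iteratedDeriv j (by exact_mod_cast (by omega : j ≤ n))).continuousAt
        have c2 : ContinuousAt (fun r : ℝ => (r : ℂ) ^ (q - 1)) b :=
          (Complex.continuous_ofReal.continuousAt).zpow₀ _ (Or.inl hbc)
        have c3 : ContinuousAt (fun r : ℝ => exp (I * t * (r : ℂ) ^ 2)) b := by fun_prop
        exact c3.mul (c1.mul c2)
      have v : T j (q - 1) b = 0 := by simp [hT, hz j (by omega)]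
      have := c.tendsto
      rw [v] at this
      exact this.mono_left nhdsWithin_le_nhds
    have ftc := intervalIntegral.integral_eq_sub_of_hasDerivAt_of_tendsto hb0 hd hint l0 lb
    rw [intervalIntegral.integral_add ((i0.const_mul _).add i1) (i2.const_mul _),
      intervalIntegral.integral_add (i0.const_mul _) i1,
      intervalIntegral.integral_const_mul, intervalIntegral.integral_const_mul, sub_zero] at ftc
    set A0 := ∫ r in (0 : ℝ)..b, T j q r
    set A1 := ∫ r in (0 : ℝ)..b, T (j + 1) (q - 1) r
    set A2 := ∫ r in (0 : ℝ)..b, T j (q - 2) r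
    have e : 2 * I * t * A0 = -(A1 + ((q : ℂ) - 1) * A2) := by linear_combination ftc
    have e' : 2 * |t| * ‖A0‖ ≤ ‖A1‖ + |(q : ℝ) - 1| * ‖A2‖ := by
      have hn : ‖2 * I * t * A0‖ = 2 * |t| * ‖A0‖ := by simp
      have hq' : ‖(q : ℂ) - 1‖ = |(q : ℝ) - 1| := by
        rw [← Real.norm_eq_abs, ← norm_real]; push_cast; rfl
      rw [← hn, e, norm_neg, ← hq', ← norm_mul]
      exact norm_add_le _ _
    have hp : 0 ≤ |t| ^ N := by positivity
    calc |t| ^ (N + 1) * ‖A0‖ = |t| ^ N * (2 * |t| * ‖A0‖) / 2 := by ring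
      _ ≤ |t| ^ N * (‖A1‖ + |(q : ℝ) - 1| * ‖A2‖) / 2 := by gcongr
      _ = (|t| ^ N * ‖A1‖ + |(q : ℝ) - 1| * (|t| ^ N * ‖A2‖)) / 2 := by ring
      _ ≤ _ := by gcongr

lemma prod_bound {E : Type*} [NormedAddCommGroup E] [NormedSpace ℝ E] (M : ℕ) (b C G : ℝ)
    (hb : 1 ≤ b) (hC : 0 ≤ C) (hG : 0 ≤ G) (R g : E → ℂ) (hR : ContDiff ℝ M R)
    (hg : ContDiff ℝ M g)
    (hRder : ∀ k ≤ M, ∀ μ : E, ‖iteratedFDeriv ℝ k R μ‖ ≤ C * ‖μ‖ ^ (2 * M + 1 - k))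
    (hgder : ∀ k ≤ M, ∀ μ : E, ‖μ‖ ≤ b → ‖iteratedFDeriv ℝ k g μ‖ ≤ G)
    (k : ℕ) (hk : k ≤ M) (μ : E) (hμ : ‖μ‖ ≤ b) :
    ‖iteratedFDeriv ℝ k (fun x => R x * g x) μ‖ ≤
      2 ^ M * (C * b ^ M * G) * ‖μ‖ ^ (2 * M + 1 - k) := by
  refine (norm_iteratedFDeriv_mul_le hR hg μ (n := k) (by exact_mod_cast hk)).trans ?_
  have hb0 : 0 ≤ b := by linarith
  have h1 : ∀ i ∈ Finset.range (k + 1),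
      (k.choose i : ℝ) * ‖iteratedFDeriv ℝ i R μ‖ * ‖iteratedFDeriv ℝ (k - i) g μ‖ ≤
        (k.choose i : ℝ) * ((C * b ^ M * G) * ‖μ‖ ^ (2 * M + 1 - k)) := by
    intro i hi
    have hi' : i ≤ k := by simpa [Nat.lt_succ_iff] using hi
    have a1 := hRder i (by omega) μ
    have a2 := hgder (k - i) (by omega) μ hμ
    have a3 : ‖μ‖ ^ (2 * M + 1 - i) ≤ b ^ M * ‖μ‖ ^ (2 * M + 1 - k) := by
      have : 2 * M + 1 - i = (k - i) + (2 * M + 1 - k) := by omega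
      rw [this, pow_add]
      gcongr
      calc ‖μ‖ ^ (k - i) ≤ b ^ (k - i) := by gcongr
        _ ≤ b ^ M := pow_le_pow_right₀ hb (by omega)
    rw [mul_assoc]
    refine mul_le_mul_of_nonneg_left ?_ (Nat.cast_nonneg _)
    calc _ ≤ (C * (b ^ M * ‖μ‖ ^ (2 * M + 1 - k))) * G := by
          gcongr
          exact a1.trans (by gcongr)
      _ = _ := by ring
  refine (Finset.sum_le_sum h1).trans ?_
  rw [← Finset.sum_mul, ← Nat.cast_sum, Nat.sum_range_choose, ← mul_assoc]
  push_cast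
  gcongr
  norm_num

theorem remainder_oscillatory_decay {ℓ : ℕ} (M : ℕ) (B C : ℝ) (hB : 0 < B) (hC : 0 < C)
    (R : EuclideanSpace ℝ (Fin ℓ) → ℂ) (hR : ContDiff ℝ (2 * M + 1) R)
    (hRsupp : Function.support R ⊆ Metric.ball 0 B)
    (hRder : ∀ k : ℕ, k ≤ 2 * M + 1 → ∀ μ : EuclideanSpace ℝ (Fin ℓ),
      ‖iteratedFDeriv ℝ k R μ‖ ≤ C * ‖μ‖ ^ ((2 * M + 1 : ℝ) - k))
    (χ : EuclideanSpace ℝ (Fin ℓ) → ℝ) (hχ : ContDiff ℝ (⊤ : ℕ∞) χ)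
    (hχsupp : HasCompactSupport χ) :
    ∃ C' : ℝ, 0 < C' ∧ ∀ t : ℝ, 1 ≤ |t| →
      ‖∫ μ : EuclideanSpace ℝ (Fin ℓ),
          Complex.exp (Complex.I * t * ‖μ‖ ^ 2) * R μ * Complex.exp (-(‖μ‖ ^ 2 : ℂ)) * (χ μ : ℂ)‖
        ≤ C' * |t| ^ (-(M : ℝ)) := by
  have hRder' : ∀ k ≤ 2 * M + 1, ∀ μ : EuclideanSpace ℝ (Fin ℓ),
      ‖iteratedFDeriv ℝ k R μ‖ ≤ C * ‖μ‖ ^ (2 * M + 1 - k) := by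
    intro k hk μ
    have := hRder k hk μ
    rwa [show ((2 * M + 1 : ℝ) - k) = ((2 * M + 1 - k : ℕ) : ℝ) by
      rw [Nat.cast_sub hk]; push_cast; ring, Real.rpow_natCast] at this
  rcases Nat.eq_zero_or_pos ℓ with rfl | hℓ
  · refine ⟨1, one_pos, fun t ht => ?_⟩
    have h0 : ∀ μ, R μ = 0 := by
      intro μ
      have := hRder' 0 (by omega) μ
      rw [Subsingleton.elim μ 0] at this ⊢
      simpa using this
    simp only [h0, mul_zero, zero_mul, integral_zero, norm_zero, one_mul]
    positivity
  haveI : Nonempty (Fin ℓ) := ⟨⟨0, hℓ⟩⟩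
  haveI : Nontrivial (EuclideanSpace ℝ (Fin ℓ)) := by
    apply Module.nontrivial_of_finrank_pos (R := ℝ)
    simpa using hℓ
  set g : EuclideanSpace ℝ (Fin ℓ) → ℂ :=
    fun μ => Complex.exp (-(‖μ‖ ^ 2 : ℂ)) * (χ μ : ℂ) with hgdef
  have hg : ContDiff ℝ (⊤ : ℕ∞) g := by
    have h1 : ContDiff ℝ (⊤ : ℕ∞) (fun μ : EuclideanSpace ℝ (Fin ℓ) => ((‖μ‖ ^ 2 : ℝ) : ℂ)) :=
      Complex.ofRealCLM.contDiff.comp (contDiff_norm_sq ℝ)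
    have h2 : ContDiff ℝ (⊤ : ℕ∞) (fun μ : EuclideanSpace ℝ (Fin ℓ) => (χ μ : ℂ)) :=
      Complex.ofRealCLM.contDiff.comp hχ
    push_cast at h1
    exact h1.neg.cexp.mul h2
  have hR' : ContDiff ℝ M R := hR.of_le (by exact_mod_cast (by omega : M ≤ 2 * M + 1))
  have hg' : ContDiff ℝ M g := hg.of_le (by exact_mod_cast le_top)
  have hf : ContDiff ℝ M (fun μ => R μ * g μ) := hR'.mul hg'
  set b : ℝ := B + 1 with hbdef
  have hb0 : 0 < b := by positivity
  obtain ⟨G, hG, hGb⟩ : ∃ G : ℝ, 0 ≤ G ∧ ∀ k ≤ M, ∀ μ : EuclideanSpace ℝ (Fin ℓ), ‖μ‖ ≤ b →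
      ‖iteratedFDeriv ℝ k g μ‖ ≤ G := by
    have h1 : ∀ k : ℕ, ∃ G : ℝ, ∀ μ : EuclideanSpace ℝ (Fin ℓ), ‖μ‖ ≤ b → k ≤ M →
        ‖iteratedFDeriv ℝ k g μ‖ ≤ G := by
      intro k
      by_cases hk : k ≤ M
      · obtain ⟨G, hG⟩ := (isCompact_closedBall (0 : EuclideanSpace ℝ (Fin ℓ)) b).exists_bound_of_continuousOn
          (hg'.continuous_iteratedFDeriv (m := k) (by exact_mod_cast hk)).continuousOn
        exact ⟨G, fun μ hμ _ => hG μ (by simpa using hμ)⟩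
      · exact ⟨0, fun _ _ h => absurd h hk⟩
    choose G hG using h1
    refine ⟨∑ i ∈ Finset.range (M + 1), |G i|, by positivity, fun k hk μ hμ => ?_⟩
    refine ((hG k μ hμ hk).trans (le_abs_self _)).trans ?_
    exact Finset.single_le_sum (f := fun i => |G i|) (fun i _ => abs_nonneg _)
      (Finset.mem_range.2 (by omega))
  have hfb := prod_bound M b C G (by linarith) hC.le hG R g hR' hg'
    (fun k hk => hRder' k (by omega)) hGb
  set C1 := 2 ^ M * (C * b ^ M * G)
  have hC1 : 0 ≤ C1 := by positivity
  obtain ⟨K, hK, H⟩ := one_dim M (2 * M + 1) b C1 hb0 hC1 M 0 ((ℓ - 1 : ℕ) : ℤ) (by omega)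
    (by push_cast; omega)
  set σ := (volume : Measure (EuclideanSpace ℝ (Fin ℓ))).toSphere
  refine ⟨K * σ.real Set.univ + 1, by positivity, fun t ht => ?_⟩
  have htM : 0 < |t| ^ M := by positivity
  have hRz : ∀ μ, B ≤ ‖μ‖ → R μ = 0 := by
    intro μ hμ
    by_contra hne
    have := hRsupp hne
    simp at this
    linarith
  -- integrability
  have hcont : Continuous (fun μ : EuclideanSpace ℝ (Fin ℓ) =>
      Complex.exp (I * t * ‖μ‖ ^ 2) * (R μ * g μ)) := by
    have := hf.continuous
    fun_prop
  have hcs : HasCompactSupport (fun μ : EuclideanSpace ℝ (Fin ℓ) =>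
      Complex.exp (I * t * ‖μ‖ ^ 2) * (R μ * g μ)) := by
    refine HasCompactSupport.intro (isCompact_closedBall 0 B) fun μ hμ => ?_
    have : B < ‖μ‖ := by simpa using hμ
    simp [hRz μ this.le]
  have hpol := polar_aux volume _ (hcont.integrable_of_hasCompactSupport hcs)
  have hcongr : (fun μ : EuclideanSpace ℝ (Fin ℓ) => Complex.exp (Complex.I * t * ‖μ‖ ^ 2) * R μ *
      Complex.exp (-(‖μ‖ ^ 2 : ℂ)) * (χ μ : ℂ)) =
      fun μ => Complex.exp (I * t * ‖μ‖ ^ 2) * (R μ * g μ) := by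
    funext μ; simp only [hgdef]; ring
  rw [hcongr, hpol]
  have hinner : ∀ ω : Metric.sphere (0 : EuclideanSpace ℝ (Fin ℓ)) 1,
      ‖∫ y in Set.Ioi (0 : ℝ), (y ^ (Module.finrank ℝ (EuclideanSpace ℝ (Fin ℓ)) - 1)) •
        (Complex.exp (I * t * ‖y • (ω : EuclideanSpace ℝ (Fin ℓ))‖ ^ 2) *
          (R (y • (ω : EuclideanSpace ℝ (Fin ℓ))) * g (y • (ω : EuclideanSpace ℝ (Fin ℓ)))))‖
        ≤ K * (|t| ^ M)⁻¹ := by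
    intro ω
    have hω : ‖(ω : EuclideanSpace ℝ (Fin ℓ))‖ = 1 := by simpa using ω.2
    set L : ℝ →L[ℝ] EuclideanSpace ℝ (Fin ℓ) :=
      ContinuousLinearMap.toSpanSingleton ℝ (ω : EuclideanSpace ℝ (Fin ℓ)) with hL
    have hLn : ‖L‖ = 1 := by simp [hL, hω]
    have hLr : ∀ r : ℝ, L r = r • (ω : EuclideanSpace ℝ (Fin ℓ)) := fun r => by simp [hL]
    have hLnorm : ∀ r : ℝ, 0 ≤ r → ‖L r‖ = r := fun r hr => by
      rw [hLr, norm_smul, hω, mul_one, Real.norm_of_nonneg hr]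
    set h : ℝ → ℂ := (fun μ => R μ * g μ) ∘ L with hh
    have hhc : ContDiff ℝ M h := hf.comp L.contDiff
    have hhz : ∀ r, B ≤ r → h r = 0 := by
      intro r hr
      simp [hh, hRz (L r) (by rw [hLnorm r (by linarith)]; exact hr)]
    have hz : ∀ k ≤ M, iteratedDeriv k h b = 0 := by
      intro k _
      have : h =ᶠ[nhds b] fun _ => 0 := by
        filter_upwards [Ioi_mem_nhds (by linarith : B < b)] with r hr
        exact hhz r (le_of_lt hr)
      rw [this.iteratedDeriv_eq k]
      simp
    have hbd : ∀ k ≤ M, ∀ r ∈ Set.Ioc 0 b,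
        ‖iteratedDeriv k h r‖ ≤ C1 * r ^ (((2 * M + 1 : ℕ) : ℤ) - k) := by
      intro k hk r hr
      rw [← norm_iteratedFDeriv_eq_norm_iteratedDeriv, hh,
        L.iteratedFDeriv_comp_right hf r (by exact_mod_cast hk)]
      refine (ContinuousMultilinearMap.norm_compContinuousLinearMap_le _ _).trans ?_
      simp only [hLn, Finset.prod_const_one, mul_one]
      have := hfb k hk (L r) (by rw [hLnorm r hr.1.le]; exact hr.2)
      rw [hLnorm r hr.1.le] at this
      rwa [show ((2 * M + 1 : ℕ) : ℤ) - k = ((2 * M + 1 - k : ℕ) : ℤ) by omega, zpow_natCast]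
    have key := H h hhc hz hbd t
    rw [intervalIntegral.integral_of_le hb0.le] at key
    have heq : ∫ y in Set.Ioi (0 : ℝ), (y ^ (Module.finrank ℝ (EuclideanSpace ℝ (Fin ℓ)) - 1)) •
        (Complex.exp (I * t * ‖y • (ω : EuclideanSpace ℝ (Fin ℓ))‖ ^ 2) *
          (R (y • (ω : EuclideanSpace ℝ (Fin ℓ))) * g (y • (ω : EuclideanSpace ℝ (Fin ℓ))))) =
        ∫ r in Set.Ioc 0 b, exp (I * t * r ^ 2) *
          (iteratedDeriv 0 h r * (r : ℂ) ^ ((ℓ - 1 : ℕ) : ℤ)) := by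
      rw [setIntegral_eq_of_subset_of_forall_sdiff_eq_zero measurableSet_Ioi
        (Set.Ioc_subset_Ioi_self : Set.Ioc 0 b ⊆ Set.Ioi 0)]
      · refine setIntegral_congr_fun measurableSet_Ioc fun r hr => ?_
        have hn := hLnorm r hr.1.le
        rw [hLr] at hn
        simp only [hn, iteratedDeriv_zero, hh, Function.comp_apply, hLr, zpow_natCast,
          finrank_euclideanSpace_fin, real_smul]
        push_cast
        ring
      · intro y hy
        have hy0 : 0 < y := hy.1
        have hyb : b < y := by
          by_contra hcon
          exact hy.2 ⟨hy0, not_lt.1 hcon⟩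
        have := hRz (L y) (by rw [hLnorm y hy0.le]; linarith)
        rw [hLr] at this
        simp [this]
    rw [heq, ← div_eq_mul_inv, le_div_iff₀ htM, mul_comm]
    exact key
  refine (norm_integral_le_of_norm_le_const (.of_forall hinner)).trans ?_
  rw [Real.rpow_neg (abs_nonneg t), Real.rpow_natCast]
  have : 0 ≤ (|t| ^ M)⁻¹ := by positivity
  change K * (|t| ^ M)⁻¹ * σ.real Set.univ ≤ _
  nlinarith
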